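/- For real numbers m, n define D(m,n) = (m² − 4n)(n² + 4m) − 2mn − 27; this is the discriminant of the polynomial t³ − n t² − m t − 1, the characteristic polynomial of the Frobenius matrix [[0,0,1],[1,0,m],[0,1,n]]. Then every real point of the curve D(m,n) = 0 satisfies both inequalities (m² − 4n + 3)(n² + 4m + 3) ≥ 0 and (m² − 4n − 3)(n² + 4m − 3) ≤ 72. -/

import Mathlib

open Matrix Polynomial

/-- Discriminant of the monic cubic `t³ + p t² + q t + r`. -/
def cubicDisc (p q r : ℝ) : ℝ :=
  18 * p * q * r - 4 * p ^ 3 * r + p ^ 2 * q ^ 2 - 4 * q ^ 3 - 27 * r ^ 2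

/-- `D(m,n) = (m² − 4n)(n² + 4m) − 2mn − 27`. -/
def Dcurve (m n : ℝ) : ℝ := (m ^ 2 - 4 * n) * (n ^ 2 + 4 * m) - 2 * m * n - 27

/-- On the discriminant curve the cubic `t³ - n t² - m t - 1` has the double root `s` and the
remaining root `w ^ 2`, where `w = s⁻¹`. -/
theorem exists_param_of_Dcurve_eq_zero {m n : ℝ} (h : Dcurve m n = 0) :
    ∃ s w : ℝ, s * w = 1 ∧ n = 2 * s + w ^ 2 ∧ m = -(s ^ 2 + 2 * w) := by
  unfold Dcurve at h
  by_cases hd : n ^ 2 + 3 * m = 0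
  · obtain rfl : m = -(n ^ 2 / 3) := by linarith
    have hsq : (n ^ 3 - 27) ^ 2 = 0 := by linear_combination (-27) * h
    have hcube : (n - 3) * (n ^ 2 + 3 * n + 9) = 0 := by
      linear_combination pow_eq_zero_iff (two_ne_zero) |>.mp hsq
    have hpos : n ^ 2 + 3 * n + 9 ≠ 0 := by nlinarith [sq_nonneg (n + 3 / 2)]
    obtain rfl : n = 3 := by
      linarith [(mul_eq_zero.mp hcube).resolve_right hpos]
    exact ⟨1, 1, by norm_num, by norm_num, by norm_num⟩
  · obtain ⟨s, hs⟩ : ∃ s, s = -(9 + m * n) / (2 * (n ^ 2 + 3 * m)) := ⟨_, rfl⟩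
    have hderiv : 3 * s ^ 2 - 2 * n * s - m = 0 := by
      rw [hs]
      field_simp
      linear_combination (-9) * h
    have hroot : s ^ 3 - n * s ^ 2 - m * s - 1 = 0 := by
      have hs' : 2 * (n ^ 2 + 3 * m) * s = -(9 + m * n) := by
        rw [hs]
        field_simp
      have hmul : (2 * (n ^ 2 + 3 * m)) ^ 3 * (s ^ 3 - n * s ^ 2 - m * s - 1) = 0 := by
        linear_combination (27 + 9 * m * n + 2 * n ^ 3) * h +
          ((2 * (n ^ 2 + 3 * m) * s) ^ 2 - 2 * (n ^ 2 + 3 * m) * s * (9 + m * n)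
            + (9 + m * n) ^ 2
            - 2 * (n ^ 2 + 3 * m) * n * (2 * (n ^ 2 + 3 * m) * s - (9 + m * n))
            - 4 * (n ^ 2 + 3 * m) ^ 2 * m) * hs'
      exact (mul_eq_zero.mp hmul).resolve_left (pow_ne_zero 3 (mul_ne_zero two_ne_zero hd))
    have hs0 : s ≠ 0 := by
      rintro rfl
      norm_num at hroot
    have hn : n = 2 * s + s⁻¹ ^ 2 := by
      field_simp
      linear_combination hroot - s * hderiv
    refine ⟨s, s⁻¹, mul_inv_cancel₀ hs0, hn, ?_⟩
    have hm : m = 3 * s ^ 2 - 2 * n * s := by linarith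
    rw [hm, hn]
    field_simp
    ring

/-- `D(m,n)` is the discriminant of `t³ − n t² − m t − 1`, the
characteristic polynomial of the Frobenius matrix `[[0,0,1],[1,0,m],[0,1,n]]`; and
every real point of the curve `D(m,n) = 0` satisfies
`(m² − 4n + 3)(n² + 4m + 3) ≥ 0` and `(m² − 4n − 3)(n² + 4m − 3) ≤ 72`. -/
theorem statement9 :
    (∀ m n : ℝ,
      (!![0, 0, 1; 1, 0, m; 0, 1, n] : Matrix (Fin 3) (Fin 3) ℝ).charpoly =
        X ^ 3 - C n * X ^ 2 - C m * X - 1) ∧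
    (∀ m n : ℝ, Dcurve m n = cubicDisc (-n) (-m) (-1)) ∧
    (∀ m n : ℝ, Dcurve m n = 0 →
      (m ^ 2 - 4 * n + 3) * (n ^ 2 + 4 * m + 3) ≥ 0 ∧
      (m ^ 2 - 4 * n - 3) * (n ^ 2 + 4 * m - 3) ≤ 72) := by
  refine ⟨fun m n => ?_, fun m n => ?_, fun m n h => ?_⟩
  · simp [Matrix.charpoly, Matrix.charmatrix, Matrix.det_fin_three]
    ring
  · unfold Dcurve cubicDisc
    ring
  · obtain ⟨s, w, hsw, rfl, rfl⟩ := exists_param_of_Dcurve_eq_zero h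
    have hA : (-(s ^ 2 + 2 * w)) ^ 2 - 4 * (2 * s + w ^ 2) = s ^ 4 - 4 * s := by
      linear_combination 4 * s * hsw
    have hB : (2 * s + w ^ 2) ^ 2 + 4 * -(s ^ 2 + 2 * w) = w ^ 4 - 4 * w := by
      linear_combination 4 * w * hsw
    rw [hA, hB]
    have quartic_nonneg (x : ℝ) : 0 ≤ x ^ 4 - 4 * x + 3 := by
      nlinarith [sq_nonneg (x ^ 2 - 1), sq_nonneg (x - 1)]
    refine ⟨mul_nonneg (quartic_nonneg s) (quartic_nonneg w), ?_⟩
    obtain rfl : w = s⁻¹ := eq_inv_of_mul_eq_one_right hsw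
    have hs0 : s ≠ 0 := left_ne_zero_of_mul_eq_one hsw
    have key : (s ^ 4 - 4 * s - 3) * (s⁻¹ ^ 4 - 4 * s⁻¹ - 3) =
        72 - (3 * (s + s⁻¹) ^ 4 + 4 * (s + s⁻¹) ^ 3 - 12 * (s + s⁻¹) ^ 2
          - 24 * (s + s⁻¹) + 52) := by
      field_simp
      ring
    rw [key]
    generalize s + s⁻¹ = x
    nlinarith [sq_nonneg (3 * x ^ 2 + 2 * x - 10), sq_nonneg (x - 1), sq_nonneg (x ^ 2 + 2 * x / 3 - 4)]
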